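/- The cover pebbling number of the even cycle C_{2k} is 3(2^k − 1), and the cover pebbling number of the odd cycle C_{2k−1} is 2^{k+1} − 3. -/

import Mathlib

open SimpleGraph

variable {V : Type*}

/-- A single pebbling move: remove two pebbles from `u`, add one to a neighbor `v`. -/
def PebblingMove (G : SimpleGraph V) (c c' : V → ℕ) : Prop :=
  ∃ u v, G.Adj u v ∧ 2 ≤ c u ∧
    c' u = c u - 2 ∧ c' v = c v + 1 ∧ ∀ w, w ≠ u → w ≠ v → c' w = c w

/-- `c'` is reachable from `c` by a sequence of pebbling moves. -/
def PebblingReach (G : SimpleGraph V) (c c' : V → ℕ) : Prop :=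
  Relation.ReflTransGen (PebblingMove G) c c'

/-- A configuration is `t`-fold `r`-solvable if some sequence of pebbling moves
places at least `t` pebbles on `r`. -/
def PebblingSolvable (G : SimpleGraph V) (c : V → ℕ) (r : V) (t : ℕ) : Prop :=
  ∃ c', PebblingReach G c c' ∧ t ≤ c' r

variable [Fintype V]

/-- The set of sizes `m` such that every configuration of size `m` is
`t`-fold `r`-solvable for every target `r`. -/
def pebblingSet (G : SimpleGraph V) (t : ℕ) : Set ℕ :=
  {m | ∀ c : V → ℕ, (∑ v, c v) = m → ∀ r : V, PebblingSolvable G c r t}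

/-- The `t`-fold pebbling number, as an extended natural number
(`⊤` when no bound exists, e.g. for disconnected graphs). -/
noncomputable def pebblingNumber (G : SimpleGraph V) (t : ℕ) : ℕ∞ :=
  sInf ((↑) '' pebblingSet G t)

/-- A configuration is cover-solvable if pebbling moves can reach a configuration
with at least one pebble on every vertex. -/
def IsCoverSolvable (G : SimpleGraph V) (c : V → ℕ) : Prop :=
  ∃ c', PebblingReach G c c' ∧ ∀ v : V, 1 ≤ c' v

/-- The cover pebbling number. -/
noncomputable def coverPebblingNumber (G : SimpleGraph V) : ℕ∞ :=
  sInf ((↑) '' {m : ℕ | ∀ c : V → ℕ, (∑ v, c v) = m → IsCoverSolvable G c})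

/-- The optimal pebbling number: the least size of a single configuration that is
`r`-solvable for every vertex `r`. -/
noncomputable def optimalPebblingNumber (G : SimpleGraph V) : ℕ∞ :=
  sInf ((↑) '' {m : ℕ | ∃ c : V → ℕ, (∑ v, c v) = m ∧ ∀ r : V, PebblingSolvable G c r 1})


/-- Geodesics as sequences of vertices. -/
lemma exists_geodesic (G : SimpleGraph V) (hG : G.Connected) (f t : V) :
    ∃ x : ℕ → V, x 0 = f ∧ x (G.dist f t) = t ∧
      (∀ i < G.dist f t, G.Adj (x i) (x (i + 1))) ∧
      ∀ i ≤ G.dist f t, G.dist f (x i) = i ∧ G.dist (x i) t = G.dist f t - i := by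
  obtain ⟨w, hw⟩ := hG.exists_walk_length_eq_dist f t
  have hadj : ∀ i < G.dist f t, G.Adj (w.getVert i) (w.getVert (i + 1)) := by
    intro i hi
    exact w.adj_getVert_succ (by omega)
  have h0 : w.getVert 0 = f := by simp
  have hd : w.getVert (G.dist f t) = t := by rw [← hw]; simp
  refine ⟨w.getVert, h0, hd, hadj, ?_⟩
  have h1 : ∀ i ≤ G.dist f t, G.dist f (w.getVert i) ≤ i := by
    intro i
    induction i with
    | zero => simp
    | succ i ih =>
      intro hi
      have := hG.dist_triangle (u := f) (v := w.getVert i) (w := w.getVert (i + 1))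
      have h2 := SimpleGraph.dist_eq_one_iff_adj.2 (hadj i (by omega))
      have := ih (by omega)
      omega
  have h2 : ∀ j ≤ G.dist f t, G.dist (w.getVert (G.dist f t - j)) t ≤ j := by
    intro j
    induction j with
    | zero => simp [hd]
    | succ j ih =>
      intro hj
      have := hG.dist_triangle (u := w.getVert (G.dist f t - (j + 1)))
        (v := w.getVert (G.dist f t - j)) (w := t)
      have h2 := SimpleGraph.dist_eq_one_iff_adj.2 (hadj (G.dist f t - (j + 1)) (by omega))
      rw [show G.dist f t - (j + 1) + 1 = G.dist f t - j by omega] at h2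
      have := ih (by omega)
      omega
  intro i hi
  have a := h1 i hi
  have b := h2 (G.dist f t - i) (by omega)
  rw [show G.dist f t - (G.dist f t - i) = i by omega] at b
  have := hG.dist_triangle (u := f) (v := w.getVert i) (w := t)
  omega

/-- Sending one pebble along a path of singly covered vertices, consuming their pebbles. -/
lemma maneuver [DecidableEq V] (G : SimpleGraph V) (c : V → ℕ) (x : ℕ → V) (d : ℕ)
    (hadj : ∀ i < d, G.Adj (x i) (x (i + 1)))
    (hinj : ∀ i ≤ d, ∀ j ≤ d, x i = x j → i = j)
    (h2 : 2 ≤ c (x 0)) (h1 : ∀ i, 0 < i → i < d → c (x i) = 1) :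
    ∀ j, 1 ≤ j → j ≤ d → PebblingReach G c
      (fun u => if u = x 0 then c u - 2 else if u = x j then c u + 1
        else if u ∈ (Finset.Ico 1 j).image x then 0 else c u) := by
  intro j hj
  induction j, hj using Nat.le_induction with
  | base =>
    intro hd
    refine Relation.ReflTransGen.single ⟨x 0, x 1, hadj 0 (by omega), h2, by simp, ?_, ?_⟩
    · have : x 1 ≠ x 0 := fun h => by have := hinj 1 hd 0 (by omega) h; omega
      simp [this]
    · intro w hw hw'
      simp [hw, hw']
  | succ j hj ih =>
    intro hd
    have e1 : x j ≠ x 0 := fun h => by have := hinj j (by omega) 0 (by omega) h; omega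
    have e2 : x (j + 1) ≠ x 0 := fun h => by have := hinj _ hd 0 (by omega) h; omega
    have e3 : x (j + 1) ≠ x j := fun h => by have := hinj _ hd j (by omega) h; omega
    have e4 : x (j + 1) ∉ (Finset.Ico 1 j).image x := by
      intro h
      obtain ⟨i, hi, hx⟩ := Finset.mem_image.1 h
      rw [Finset.mem_Ico] at hi
      have := hinj i (by omega) _ hd hx
      omega
    have e5 : (Finset.Ico 1 (j + 1)).image x = insert (x j) ((Finset.Ico 1 j).image x) := by
      rw [← Finset.image_insert]
      congr 1
      ext i
      simp only [Finset.mem_Ico, Finset.mem_insert]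
      omega
    have e6 := h1 j (by omega) (by omega)
    refine Relation.ReflTransGen.tail (ih (by omega)) ⟨x j, x (j + 1), hadj j (by omega), ?_, ?_, ?_, ?_⟩
    · simp [e1, e6]
    · simp only [e5]
      simp [e1, e3.symm, e6]
    · simp only [if_neg e2, if_neg e3, if_neg e4, if_true]
    · intro w hw hw'
      have e7 : w ∈ (Finset.Ico 1 (j + 1)).image x ↔ w ∈ (Finset.Ico 1 j).image x := by
        rw [e5, Finset.mem_insert]
        exact or_iff_right hw
      simp only [if_neg hw, if_neg hw', e7]

/-- The stacking theorem (for the unit cover goal). -/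
lemma cover_core [DecidableEq V] (G : SimpleGraph V) (hG : G.Connected) (N : ℕ)
    (hN : ∀ v, ∑ u, 2 ^ G.dist v u ≤ N) :
    ∀ n : ℕ, ∀ (c val : V → ℕ) (r : V), ∑ v, c v = n →
      (∀ u, c u = 0 → val u = 0) → (∀ u, 2 ≤ c u → val u = c u) →
      (∀ u g, c u = 1 → (2 ≤ c g ∨ g = r) → val u ≤ 2 ^ G.dist g u) →
      N ≤ ∑ v, val v → IsCoverSolvable G c := by
  intro n
  induction n using Nat.strong_induction_on with
  | _ n ih =>
  intro c val r hc hv0 hv2 hv1 hsum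
  by_cases hthin : ∃ t, c t = 0
  swap
  · push Not at hthin
    exact ⟨c, Relation.ReflTransGen.refl, fun v => Nat.one_le_iff_ne_zero.2 (hthin v)⟩
  by_cases hfat : ∃ f, 2 ≤ c f
  swap
  · exfalso
    push Not at hfat
    obtain ⟨t, ht⟩ := hthin
    have : ∑ v, val v < ∑ u, 2 ^ G.dist r u := by
      apply Finset.sum_lt_sum
      · intro u _
        have := hfat u
        rcases Nat.eq_zero_or_pos (c u) with h | h
        · simp [hv0 u h]
        · exact hv1 u r (by omega) (Or.inr rfl)
      · exact ⟨t, Finset.mem_univ _, by rw [hv0 t ht]; positivity⟩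
    have := hN r
    omega
  obtain ⟨t0, ht0⟩ := hthin
  obtain ⟨f0, hf0⟩ := hfat
  obtain ⟨⟨f, t⟩, hft, hmin⟩ := Finset.exists_min_image
    ((Finset.univ : Finset (V × V)).filter (fun q => 2 ≤ c q.1 ∧ c q.2 = 0))
    (fun q => G.dist q.1 q.2) ⟨(f0, t0), by simp [hf0, ht0]⟩
  simp only [Finset.mem_filter, Finset.mem_univ, true_and] at hft
  obtain ⟨hf, ht⟩ := hft
  have hmin' : ∀ g s, 2 ≤ c g → c s = 0 → G.dist f t ≤ G.dist g s := fun g s hg hs =>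
    hmin (g, s) (by simp [hg, hs])
  have hne : f ≠ t := by rintro rfl; omega
  have hdpos : 0 < G.dist f t := hG.pos_dist_of_ne hne
  obtain ⟨x, hx0, hxd, hadj, hdist⟩ := exists_geodesic G hG f t
  set d := G.dist f t with hd
  have hinj : ∀ i ≤ d, ∀ j ≤ d, x i = x j → i = j := by
    intro i hi j hj h
    have a := (hdist i hi).1
    have b := (hdist j hj).1
    rw [h] at a
    omega
  have h1 : ∀ i, 0 < i → i < d → c (x i) = 1 := by
    intro i hi hid
    have a := hdist i hid.le
    by_contra hcon
    rcases Nat.lt_or_ge (c (x i)) 2 with h | h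
    · have := hmin' f (x i) hf (by omega)
      omega
    · have := hmin' (x i) t h ht
      omega
  have hreach := maneuver G c x d hadj hinj (by rw [hx0]; exact hf) h1 d hdpos le_rfl
  rw [hx0, hxd] at hreach
  set I := (Finset.Ico 1 d).image x with hI
  have hIf : f ∉ I := by
    intro h
    obtain ⟨i, hi, hx⟩ := Finset.mem_image.1 h
    rw [Finset.mem_Ico] at hi
    have := hinj i (by omega) 0 (by omega) (by rw [hx, hx0])
    omega
  have hIt : t ∉ I := by
    intro h
    obtain ⟨i, hi, hx⟩ := Finset.mem_image.1 h
    rw [Finset.mem_Ico] at hi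
    have := hinj i (by omega) d (by omega) (by rw [hx, hxd])
    omega
  have hI1 : ∀ u ∈ I, c u = 1 := by
    intro u h
    obtain ⟨i, hi, hx⟩ := Finset.mem_image.1 h
    rw [Finset.mem_Ico] at hi
    rw [← hx]
    exact h1 i (by omega) (by omega)
  have hpow : ∀ m, 1 ≤ m → 2 + ∑ i ∈ Finset.Ico 1 m, 2 ^ i = 2 ^ m := by
    intro m hm
    induction m, hm using Nat.le_induction with
    | base => simp
    | succ m hm ih => rw [Finset.sum_Ico_succ_top hm, ← add_assoc, ih, pow_succ]; ring
  have hS : 2 + ∑ u ∈ I, val u ≤ 2 ^ d := by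
    rw [← hpow d hdpos, hI, Finset.sum_image]
    · gcongr with i hi
      rw [Finset.mem_Ico] at hi
      have := hv1 (x i) f (h1 i (by omega) (by omega)) (Or.inl hf)
      rwa [(hdist i (by omega)).1] at this
    · intro i hi j hj h
      simp only [Finset.coe_Ico, Set.mem_Ico] at hi hj
      exact hinj i (by omega) j (by omega) h
  set c' : V → ℕ := fun u => if u = f then c u - 2 else if u = t then c u + 1
        else if u ∈ I then 0 else c u with hc'
  set val' : V → ℕ := fun u => if u = f then c u - 2 else if u = t then 2 + ∑ u ∈ I, val u
        else if u ∈ I then 0 else val u with hval'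
  have key : IsCoverSolvable G c' := by
    have hsc : ∑ u, c' u + 2 + I.card = n + 1 := by
      have : ∑ u, (c' u + (if u = f then 2 else 0) + (if u ∈ I then 1 else 0))
          = ∑ u, (c u + if u = t then 1 else 0) := by
        refine Finset.sum_congr rfl fun u _ => ?_
        simp only [hc']
        by_cases a : u = f
        · subst a; simp [hIf, hne]; omega
        by_cases b : u = t
        · subst b; simp [hIt, a]
        by_cases e : u ∈ I
        · simp [a, b, e, hI1 u e]
        · simp [a, b, e]
      simpa [Finset.sum_add_distrib, hc] using this
    have hsv : ∑ u, val' u = ∑ u, val u := by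
      have : ∑ u, (val' u + (if u = f then 2 else 0) + (if u ∈ I then val u else 0))
          = ∑ u, (val u + if u = t then (2 + ∑ u ∈ I, val u) else 0) := by
        refine Finset.sum_congr rfl fun u _ => ?_
        simp only [hval']
        by_cases a : u = f
        · subst a; simp [hIf, hne, hv2 u hf]; omega
        by_cases b : u = t
        · subst b; simp [hIt, a, hv0 u ht]
        by_cases e : u ∈ I
        · simp [a, b, e]
        · simp [a, b, e]
      simp [Finset.sum_add_distrib] at this
      omega
    refine ih (∑ u, c' u) (by omega) c' val' f rfl ?_ ?_ ?_ (by rw [hsv]; exact hsum)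
    · intro u hu
      simp only [hc'] at hu
      simp only [hval']
      split_ifs at hu ⊢ with a b e
      all_goals first | exact hu | rfl | exact hv0 u hu | omega
    · intro u hu
      simp only [hc'] at hu
      simp only [hval', hc']
      split_ifs at hu ⊢ with a b e
      · rfl
      · subst b; omega
      · rfl
      · exact hv2 u hu
    · intro u g hu hg
      have hg2 : 2 ≤ c g := by
        rcases hg with hg | rfl
        · simp only [hc'] at hg
          split_ifs at hg with a b e
          · omega
          · subst b; omega
          · omega
          · exact hg
        · exact hf
      simp only [hc'] at hu
      simp only [hval']
      split_ifs at hu ⊢ with a b e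
      · rw [hu]; exact Nat.one_le_two_pow
      · subst b
        exact hS.trans (Nat.pow_le_pow_right (by norm_num) (hmin' g u hg2 ht))
      · exact hv1 u g hu (Or.inl hg2)
  obtain ⟨c'', h, h'⟩ := key
  exact ⟨c'', Relation.ReflTransGen.trans hreach h, h'⟩

lemma weight_move (G : SimpleGraph V) (D : V → ℕ) (hD : ∀ u v, G.Adj u v → D v ≤ D u + 1)
    (c c' : V → ℕ) (h : PebblingMove G c c') :
    ∑ u, c' u * 2 ^ D u ≤ ∑ u, c u * 2 ^ D u := by
  classical
  obtain ⟨u, v, huv, h2, hu, hv, hw⟩ := h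
  have hne : u ≠ v := huv.ne
  have : ∑ w, (c' w * 2 ^ D w + if w = u then 2 * 2 ^ D w else 0) =
      ∑ w, (c w * 2 ^ D w + if w = v then 2 ^ D w else 0) := by
    refine Finset.sum_congr rfl fun w _ => ?_
    by_cases a : w = u
    · subst a
      obtain ⟨m, hm⟩ := Nat.exists_eq_add_of_le h2
      simp [hne, hu, hm]; ring
    by_cases b : w = v
    · subst b; simp [a, hv]; ring
    · simp [a, b, hw w a b]
  simp only [Finset.sum_add_distrib, Finset.sum_ite_eq', Finset.mem_univ, if_true] at this
  have h3 : 2 ^ D v ≤ 2 * 2 ^ D u := by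
    rw [← pow_succ']
    exact Nat.pow_le_pow_right (by norm_num) (hD u v huv)
  omega

lemma weight_reach (G : SimpleGraph V) (D : V → ℕ) (hD : ∀ u v, G.Adj u v → D v ≤ D u + 1)
    (c c' : V → ℕ) (h : PebblingReach G c c') :
    ∑ u, c' u * 2 ^ D u ≤ ∑ u, c u * 2 ^ D u := by
  induction h with
  | refl => exact le_rfl
  | tail _ h ih => exact (weight_move G D hD _ _ h).trans ih

/-- If all vertices have the same stacking cost `N`, then `N` is the cover pebbling number. -/
lemma coverPebblingNumber_eq (G : SimpleGraph V) (hG : G.Connected) (N : ℕ)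
    (hN : ∀ v, ∑ u, 2 ^ G.dist v u = N) : coverPebblingNumber G = (N : ℕ∞) := by
  classical
  obtain ⟨v0⟩ := hG.nonempty
  apply le_antisymm
  · refine sInf_le ⟨N, ?_, rfl⟩
    intro c hc
    refine cover_core G hG N (fun v => (hN v).le) N c c v0 hc (fun _ h => h) (fun _ _ => rfl) ?_ hc.ge
    intro u g hu _
    rw [hu]; exact Nat.one_le_two_pow
  · refine le_sInf ?_
    rintro _ ⟨m, hm, rfl⟩
    obtain ⟨c', hr, hc'⟩ := hm (Pi.single v0 m) (by simp)
    have h := weight_reach G (fun u => G.dist v0 u) (fun u v huv => by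
      have := hG.dist_triangle (u := v0) (v := u) (w := v)
      rwa [SimpleGraph.dist_eq_one_iff_adj.2 huv] at this) _ _ hr
    have h2 : ∑ u, Pi.single (M := fun _ => ℕ) v0 m u * 2 ^ G.dist v0 u = m := by
      rw [Finset.sum_eq_single v0]
      · simp
      · intro b _ hb; simp [hb]
      · simp
    have h3 : ∑ u, 2 ^ G.dist v0 u ≤ ∑ u, c' u * 2 ^ G.dist v0 u := by
      refine Finset.sum_le_sum fun u _ => ?_
      exact Nat.le_mul_of_pos_left _ (hc' u)
    rw [hN] at h3
    exact_mod_cast (h3.trans h).trans h2.le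

/-- Recognizing the distance function. -/
lemma dist_recognize (G : SimpleGraph V) (v : V) (D : V → ℕ)
    (h0 : D v = 0) (hL : ∀ a b, G.Adj a b → D b ≤ D a + 1)
    (hdesc : ∀ a, a ≠ v → ∃ b, G.Adj a b ∧ D b + 1 = D a) :
    ∀ u, G.Reachable v u ∧ G.dist v u = D u := by
  have up : ∀ n, ∀ u, D u = n → ∃ w : G.Walk u v, w.length = n := by
    intro n
    induction n with
    | zero =>
      intro u hu
      by_cases h : u = v
      · subst h; exact ⟨.nil, rfl⟩
      · obtain ⟨b, _, hb⟩ := hdesc u h; omega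
    | succ n ih =>
      intro u hu
      have h : u ≠ v := by rintro rfl; omega
      obtain ⟨b, hab, hb⟩ := hdesc u h
      obtain ⟨w, hw⟩ := ih b (by omega)
      exact ⟨.cons hab w, by simp [hw]⟩
  have low : ∀ a b (w : G.Walk a b), D a ≤ D b + w.length := by
    intro a b w
    induction w with
    | nil => simp
    | cons h w ih =>
      have := hL _ _ h.symm
      simp only [SimpleGraph.Walk.length_cons]
      omega
  intro u
  obtain ⟨w, hw⟩ := up _ u rfl
  refine ⟨w.reachable.symm, ?_⟩
  rw [SimpleGraph.dist_comm]
  apply le_antisymm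
  · exact hw ▸ SimpleGraph.dist_le w
  · obtain ⟨w', hw'⟩ := w.reachable.exists_walk_length_eq_dist
    have := low _ _ w'
    omega

lemma cycle_dist (n : ℕ) (hn : 3 ≤ n) [NeZero n] (v u : Fin n) :
    (cycleGraph n).Reachable v u ∧
      (cycleGraph n).dist v u = min (u - v).val (n - (u - v).val) := by
  obtain ⟨m, rfl⟩ : ∃ m, n = m + 3 := ⟨n - 3, by omega⟩
  have hone : ((1 : Fin (m + 3)) : ℕ) = 1 := by simp
  have hadd : ∀ a : Fin (m + 3), (a + 1).val = if a.val = m + 2 then 0 else a.val + 1 := by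
    intro a
    rw [Fin.val_add, hone]
    split_ifs with h
    · rw [h]; simp
    · exact Nat.mod_eq_of_lt (by omega)
  have hsucc : ∀ a b : Fin (m + 3), a - b = 1 →
      (a - v).val = if (b - v).val = m + 2 then 0 else (b - v).val + 1 := by
    intro a b h
    rw [← hadd, ← h]; congr 1; abel
  refine dist_recognize (cycleGraph (m + 3)) v
    (fun u => min (u - v).val (m + 3 - (u - v).val)) ?_ ?_ ?_ u
  · simp
  · intro a b hab
    rw [SimpleGraph.cycleGraph_adj] at hab
    rcases hab with h | h
    · have hs := hsucc _ _ h
      have := (b - v).isLt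
      split_ifs at hs <;> omega
    · have hs := hsucc _ _ h
      have := (a - v).isLt
      split_ifs at hs <;> omega
  · intro a ha
    have hpos : (a - v).val ≠ 0 := by
      intro h
      exact ha (sub_eq_zero.1 (Fin.ext h))
    have hlt := (a - v).isLt
    by_cases h : 2 * (a - v).val ≤ m + 3
    · refine ⟨a - 1, by rw [SimpleGraph.cycleGraph_adj]; left; abel, ?_⟩
      have hs := hsucc a (a - 1) (by abel)
      have := (a - 1 - v).isLt
      split_ifs at hs <;> omega
    · refine ⟨a + 1, by rw [SimpleGraph.cycleGraph_adj]; right; abel, ?_⟩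
      have hs := hsucc (a + 1) a (by abel)
      have := (a + 1 - v).isLt
      split_ifs at hs <;> omega

lemma cover_cycle (n : ℕ) (hn : 3 ≤ n) :
    coverPebblingNumber (cycleGraph n) =
      ((∑ i ∈ Finset.range n, 2 ^ min i (n - i) : ℕ) : ℕ∞) := by
  have : NeZero n := ⟨by omega⟩
  have hconn : (cycleGraph n).Connected :=
    { preconnected := fun v u => (cycle_dist n hn v u).1, nonempty := ⟨0⟩ }
  refine coverPebblingNumber_eq _ hconn _ fun v => ?_
  rw [Finset.sum_range (fun i => 2 ^ min i (n - i)), ← Equiv.sum_comp (Equiv.subRight v) (fun w : Fin n => 2 ^ min w.val (n - w.val))]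
  refine Finset.sum_congr rfl fun u _ => ?_
  rw [(cycle_dist n hn v u).2]
  rfl

lemma sum_low (k : ℕ) : ∑ i ∈ Finset.range k, 2 ^ i = 2 ^ k - 1 := by
  have := Nat.geomSum_eq (le_refl 2) k
  simpa using this

lemma sum_even (k : ℕ) : ∑ i ∈ Finset.range (2 * k), 2 ^ min i (2 * k - i) = 3 * (2 ^ k - 1) := by
  rw [two_mul, Finset.sum_range_add, ← Finset.sum_range_reflect (fun x => 2 ^ min (k + x) (k + k - (k + x)))]
  have a : ∑ x ∈ Finset.range k, 2 ^ min x (k + k - x) = 2 ^ k - 1 := by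
    rw [← sum_low]
    refine Finset.sum_congr rfl fun i hi => ?_
    rw [Finset.mem_range] at hi
    congr 1; omega
  have b : ∑ j ∈ Finset.range k, 2 ^ min (k + (k - 1 - j)) (k + k - (k + (k - 1 - j)))
      = 2 * (2 ^ k - 1) := by
    rw [← sum_low, Finset.mul_sum]
    refine Finset.sum_congr rfl fun i hi => ?_
    rw [Finset.mem_range] at hi
    rw [← pow_succ']
    congr 1; omega
  rw [a, b]; ring

lemma sum_odd (k : ℕ) : ∑ i ∈ Finset.range (2 * k + 1), 2 ^ min i (2 * k + 1 - i)
    = 2 ^ (k + 2) - 3 := by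
  rw [show 2 * k + 1 = (k + 1) + k by ring, Finset.sum_range_add,
    ← Finset.sum_range_reflect (fun x => 2 ^ min (k + 1 + x) (k + 1 + k - (k + 1 + x)))]
  have a : ∑ x ∈ Finset.range (k + 1), 2 ^ min x (k + 1 + k - x) = 2 ^ (k + 1) - 1 := by
    rw [← sum_low]
    refine Finset.sum_congr rfl fun i hi => ?_
    rw [Finset.mem_range] at hi
    congr 1; omega
  have b : ∑ j ∈ Finset.range k, 2 ^ min (k + 1 + (k - 1 - j)) (k + 1 + k - (k + 1 + (k - 1 - j)))
      = 2 * (2 ^ k - 1) := by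
    rw [← sum_low, Finset.mul_sum]
    refine Finset.sum_congr rfl fun i hi => ?_
    rw [Finset.mem_range] at hi
    rw [← pow_succ']
    congr 1; omega
  rw [a, b]
  have : 1 ≤ 2 ^ k := Nat.one_le_two_pow
  rw [pow_succ, pow_succ]
  omega

/-- The cover pebbling number of the even cycle `C (2k)` is `3(2^k - 1)` and of the
odd cycle `C (2k - 1)` is `2^(k+1) - 3`. -/
theorem coverPebblingNumber_cycleGraph (k : ℕ) (hk : 2 ≤ k) :
    coverPebblingNumber (cycleGraph (2 * k)) = ((3 * (2 ^ k - 1) : ℕ) : ℕ∞) ∧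
      coverPebblingNumber (cycleGraph (2 * k - 1)) = ((2 ^ (k + 1) - 3 : ℕ) : ℕ∞) := by
  constructor
  · rw [cover_cycle (2 * k) (by omega), sum_even]
  · obtain ⟨j, rfl⟩ : ∃ j, k = j + 1 := ⟨k - 1, by omega⟩
    rw [show 2 * (j + 1) - 1 = 2 * j + 1 by omega, cover_cycle (2 * j + 1) (by omega), sum_odd]
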